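/- Let M ⊆ ℝ^d be a Meyer set. Then M − M + M = {x − y + z : x, y, z ∈ M} is a Meyer set, and the additive subgroup of ℝ^d generated by M − M + M equals the additive subgroup [M] generated by M. -/

import Mathlib

open scoped Pointwise

/-- A set is relatively dense if there is `R > 0` such that every closed ball
of radius `R` meets the set. -/
def RelativelyDense {d : ℕ} (M : Set (EuclideanSpace ℝ (Fin d))) : Prop :=
  ∃ R > (0 : ℝ), ∀ y : EuclideanSpace ℝ (Fin d), ∃ x ∈ M, dist x y ≤ R

/-- A set is uniformly discrete if distinct points are at distance at least `r > 0`. -/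
def UniformlyDiscrete {d : ℕ} (S : Set (EuclideanSpace ℝ (Fin d))) : Prop :=
  ∃ r > (0 : ℝ), ∀ x ∈ S, ∀ y ∈ S, x ≠ y → r ≤ dist x y

/-- A Meyer set: relatively dense with uniformly discrete difference set. -/
def IsMeyer {d : ℕ} (M : Set (EuclideanSpace ℝ (Fin d))) : Prop :=
  RelativelyDense M ∧ UniformlyDiscrete (M - M)

theorem exists_ncard_le_of_separated {d : ℕ} (ρ : ℝ) {r : ℝ} (hr : 0 < r) :
    ∃ N : ℕ, ∀ S : Set (EuclideanSpace ℝ (Fin d)), S ⊆ Metric.closedBall 0 ρ →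
      (∀ x ∈ S, ∀ y ∈ S, x ≠ y → r ≤ dist x y) → S.Finite ∧ S.ncard ≤ N := by
  obtain ⟨T, hT, hcov⟩ := Metric.totallyBounded_iff.1
    (isCompact_closedBall (0 : EuclideanSpace ℝ (Fin d)) ρ).totallyBounded (r / 2) (half_pos hr)
  refine ⟨T.ncard, fun S hS hsep => ?_⟩
  have hcell : ∀ x : EuclideanSpace ℝ (Fin d), ∃ c, x ∈ S → c ∈ T ∧ dist x c < r / 2 := by
    intro x
    by_cases hx : x ∈ S
    · obtain ⟨c, hc, hxc⟩ := Set.mem_iUnion₂.1 (hcov (hS hx))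
      exact ⟨c, fun _ => ⟨hc, hxc⟩⟩
    · exact ⟨0, fun h => absurd h hx⟩
  choose c hc using hcell
  have hmaps : Set.MapsTo c S T := fun x hx => (hc x hx).1
  have hinj : Set.InjOn c S := by
    intro x hx y hy hxy
    by_contra hne
    have h₁ := (hc x hx).2
    have h₂ := (hc y hy).2
    rw [hxy] at h₁
    linarith [hsep x hx y hy hne, dist_triangle_right x y (c y)]
  exact ⟨Set.Finite.of_injOn hmaps hinj hT, Set.ncard_le_ncard_of_injOn c hmaps hinj hT⟩

theorem UniformlyDiscrete.finite_inter_closedBall {d : ℕ} {S : Set (EuclideanSpace ℝ (Fin d))}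
    (hS : UniformlyDiscrete S) (ρ : ℝ) : (S ∩ Metric.closedBall 0 ρ).Finite := by
  obtain ⟨r, hr, hsep⟩ := hS
  obtain ⟨N, hN⟩ := exists_ncard_le_of_separated (d := d) ρ hr
  exact (hN _ Set.inter_subset_right fun x hx y hy => hsep x hx.1 y hy.1).1

/-- Any two points of a set with covering radius `R` are joined by a chain of points of the set
with steps of length at most `2 * R + 1`, stated as an induction principle. -/
theorem forall_mem_of_step {d : ℕ} {M : Set (EuclideanSpace ℝ (Fin d))} {R : ℝ} (hR : 0 < R)
    (hM : ∀ y : EuclideanSpace ℝ (Fin d), ∃ x ∈ M, dist x y ≤ R)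
    {P : EuclideanSpace ℝ (Fin d) → Prop} {t₀ : EuclideanSpace ℝ (Fin d)} (ht₀ : t₀ ∈ M)
    (h₀ : P t₀) (hstep : ∀ t ∈ M, ∀ t' ∈ M, dist t' t ≤ 2 * R + 1 → P t → P t') :
    ∀ t ∈ M, P t := by
  have key : ∀ n : ℕ, ∀ t ∈ M, dist t t₀ ≤ n → P t := by
    intro n
    induction n with
    | zero =>
      intro t _ h
      have : t = t₀ := dist_le_zero.1 (by simpa using h)
      rwa [this]
    | succ n ih =>
      intro t ht h
      push_cast at h
      by_cases hnear : dist t t₀ ≤ R + 1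
      · exact hstep t₀ ht₀ t ht (by linarith) h₀
      · push Not at hnear
        set L := dist t t₀ with hL
        have hLpos : 0 < L := by linarith
        obtain ⟨q, hq, hqd⟩ := hM (AffineMap.lineMap t t₀ ((R + 1) / L))
        have h₁ : dist (AffineMap.lineMap t t₀ ((R + 1) / L)) t = R + 1 := by
          rw [dist_lineMap_left, ← hL, Real.norm_of_nonneg (by positivity)]
          field_simp
        have h₂ : dist (AffineMap.lineMap t t₀ ((R + 1) / L)) t₀ = L - (R + 1) := by
          have : 0 ≤ 1 - (R + 1) / L := by
            rw [sub_nonneg, div_le_one hLpos]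
            exact hnear.le
          rw [dist_lineMap_right, ← hL, Real.norm_of_nonneg this]
          field_simp
        refine hstep q hq t ht ?_ (ih q hq ?_)
        · rw [dist_comm]
          linarith [dist_triangle q (AffineMap.lineMap t t₀ ((R + 1) / L)) t]
        · linarith [dist_triangle q (AffineMap.lineMap t t₀ ((R + 1) / L)) t₀]
  intro t ht
  obtain ⟨n, hn⟩ := exists_nat_ge (dist t t₀)
  exact key n t ht hn

theorem Set.Finite.nsmul_set {G : Type*} [AddMonoid G] {K : Set G} (hK : K.Finite) (n : ℕ) :
    (n • K).Finite := by
  induction n with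
  | zero => simp
  | succ n ih =>
    rw [succ_nsmul]
    exact ih.add hK

/-- A finite set that leaves each `k • K` not containing it through a step in `K` is contained in
`n • K` once `n` is at least its cardinality. -/
theorem subset_nsmul_of_step {G : Type*} [AddMonoid G] {A K : Set G} (hA : A.Finite)
    (hK : (0 : G) ∈ K)
    (hstep : ∀ k : ℕ, (∀ a ∈ A, a ∈ k • K → ∀ b ∈ A, b ∈ a +ᵥ K → b ∈ k • K) → A ⊆ k • K)
    {n : ℕ} (hn : A.ncard ≤ n) : A ⊆ n • K := by
  have hmono : ∀ k : ℕ, k • K ⊆ (k + 1) • K := by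
    intro k a ha
    rw [succ_nsmul]
    exact ⟨a, ha, 0, hK, add_zero a⟩
  have key : ∀ k : ℕ, A ⊆ k • K ∨ k ≤ (A ∩ k • K).ncard := by
    intro k
    induction k with
    | zero => simp
    | succ k ih =>
      rcases ih with ih | ih
      · exact Or.inl (ih.trans (hmono k))
      by_cases hsub : A ⊆ k • K
      · exact Or.inl (hsub.trans (hmono k))
      right
      have hout := mt (hstep k) hsub
      push Not at hout
      obtain ⟨a, ha, hak, b, hb, ⟨c, hc, rfl⟩, hbk⟩ := hout
      refine ih.trans_lt (Set.ncard_lt_ncard ⟨Set.inter_subset_inter_right A (hmono k), ?_⟩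
        (hA.subset Set.inter_subset_left))
      intro hle
      refine hbk (hle ⟨hb, ?_⟩).2
      rw [succ_nsmul]
      exact ⟨a, hak, c, hc, rfl⟩
  rcases key n with h | h
  · exact h
  · have heq : A ∩ n • K = A :=
      Set.eq_of_subset_of_ncard_le Set.inter_subset_left (hn.trans h) hA
    exact Set.inter_eq_left.1 heq

theorem IsMeyer.exists_finite_sub_subset {d : ℕ} {M : Set (EuclideanSpace ℝ (Fin d))}
    (hM : IsMeyer M) :
    ∃ F : Set (EuclideanSpace ℝ (Fin d)), F.Finite ∧ M - M ⊆ M + F := by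
  obtain ⟨⟨R, hR, hcov⟩, hD⟩ := hM
  obtain ⟨t₀, ht₀, -⟩ := hcov 0
  set F₁ := (M - M) ∩ Metric.closedBall 0 (4 * R + 1) with hF₁
  have hF₁fin : F₁.Finite := hD.finite_inter_closedBall _
  have hF₁zero : (0 : EuclideanSpace ℝ (Fin d)) ∈ F₁ :=
    ⟨⟨t₀, ht₀, t₀, ht₀, sub_self t₀⟩, by simp; linarith⟩
  set K := F₁ - F₁ with hK
  have hKzero : (0 : EuclideanSpace ℝ (Fin d)) ∈ K := ⟨0, hF₁zero, 0, hF₁zero, sub_self 0⟩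
  obtain ⟨r, hr, hsep⟩ := hD
  obtain ⟨N, hN⟩ := exists_ncard_le_of_separated (d := d) R hr
  have hKfin : (N • K).Finite := (hF₁fin.sub hF₁fin).nsmul_set N
  refine ⟨(fun k => -t₀ - k) '' (N • K), hKfin.image _, ?_⟩
  rintro _ ⟨x, hx, y, hy, rfl⟩
  have hg : ∃ g : EuclideanSpace ℝ (Fin d) → EuclideanSpace ℝ (Fin d),
      g y = x ∧ ∀ t, g t ∈ M ∧ dist (g t) (t + (x - y)) ≤ R := by
    classical
    choose q hqM hq using hcov
    refine ⟨fun t => if t = y then x else q (t + (x - y)), by simp, fun t => ?_⟩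
    by_cases ht : t = y
    · simp [ht, hx, hR.le]
    · simp only [ht, if_false]
      exact ⟨hqM _, hq _⟩
  obtain ⟨g, hgy, hg⟩ := hg
  set e : EuclideanSpace ℝ (Fin d) → EuclideanSpace ℝ (Fin d) := fun t => g t - t - (x - y) with he
  have henorm : ∀ t, ‖e t‖ ≤ R := by
    intro t
    have := (hg t).2
    rwa [dist_eq_norm, ← sub_sub] at this
  obtain ⟨hAfin, hAcard⟩ := hN (e '' M)
    (by
      rintro _ ⟨t, -, rfl⟩
      simpa using henorm t)
    (by
      rintro _ ⟨t, ht, rfl⟩ _ ⟨s, hs, rfl⟩ hne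
      have h := hsep (g t - t) ⟨_, (hg t).1, _, ht, rfl⟩ (g s - s) ⟨_, (hg s).1, _, hs, rfl⟩
        (fun h => hne (by simp only [he, h]))
      simpa only [he, dist_sub_right] using h)
  have hsub : e '' M ⊆ N • K := by
    refine subset_nsmul_of_step hAfin hKzero (fun k hk => ?_) hAcard
    rintro _ ⟨t, ht, rfl⟩
    refine forall_mem_of_step hR hcov (P := fun t => e t ∈ k • K) hy ?_ ?_ t ht
    · have hey : e y = 0 := by simp [he, hgy]
      rw [hey]
      simpa using Set.nsmul_mem_nsmul (n := k) hKzero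
    · intro s hs s' hs' hss hsk
      refine hk (e s) ⟨s, hs, rfl⟩ hsk (e s') ⟨s', hs', rfl⟩ ?_
      rw [dist_eq_norm] at hss
      refine ⟨e s' - e s, ⟨g s' - g s, ⟨⟨_, (hg s').1, _, (hg s).1, rfl⟩, ?_⟩, s' - s,
        ⟨⟨_, hs', _, hs, rfl⟩, ?_⟩, ?_⟩, ?_⟩
      · have heq : g s' - g s = (s' - s) + (e s' - e s) := by simp only [he]; abel
        rw [mem_closedBall_zero_iff, heq]
        linarith [norm_add_le (s' - s) (e s' - e s), norm_sub_le (e s') (e s), henorm s, henorm s']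
      · rw [mem_closedBall_zero_iff]
        linarith
      · simp only [he]; abel
      · simp
  refine ⟨g t₀, (hg t₀).1, _, ⟨e t₀, hsub ⟨t₀, ht₀, rfl⟩, rfl⟩, ?_⟩
  simp only [he]; abel

theorem exists_finite_nsmul_sub_subset {G : Type*} [AddCommGroup G] {M F : Set G}
    (hF : F.Finite) (hM : M - M ⊆ M + F) (n : ℕ) :
    ∃ F' : Set G, F'.Finite ∧ (n + 1) • (M - M) ⊆ M + F' := by
  induction n with
  | zero => exact ⟨F, hF, by simpa using hM⟩
  | succ n ih =>
    obtain ⟨F', hF', h⟩ := ih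
    refine ⟨F + (F' - F), hF.add (hF'.sub hF), ?_⟩
    rw [succ_nsmul]
    rintro _ ⟨a, ha, _, ⟨x, hx, y, hy, rfl⟩, rfl⟩
    obtain ⟨m, hm, f, hf, rfl⟩ := h ha
    obtain ⟨m', hm', f', hf', hyx⟩ := hM ⟨y, hy, x, hx, rfl⟩
    obtain ⟨m'', hm'', f'', hf'', hmm⟩ := hM ⟨m, hm, m', hm', rfl⟩
    refine ⟨m'', hm'', f'' + (f - f'), ⟨f'', hf'', _, ⟨f, hf, f', hf', rfl⟩, rfl⟩, ?_⟩
    have hxy : x - y = -(m' + f') := by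
      rw [← neg_sub y x]
      exact congrArg Neg.neg hyx.symm
    simp only at hmm ⊢
    rw [hxy, ← add_assoc, hmm]
    abel

theorem uniformlyDiscrete_of_finite_sub {d : ℕ} {S : Set (EuclideanSpace ℝ (Fin d))}
    (hS : ((S - S) ∩ Metric.closedBall 0 1).Finite) : UniformlyDiscrete S := by
  have hopen : IsOpen (((S - S) ∩ Metric.closedBall 0 1) \ {0})ᶜ :=
    (hS.subset Set.sdiff_subset).isClosed.isOpen_compl
  obtain ⟨ε, hε, hball⟩ := Metric.isOpen_iff.1 hopen 0 (by simp)
  refine ⟨min ε 1, lt_min hε one_pos, fun x hx y hy hne => ?_⟩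
  by_contra! hlt
  rw [dist_eq_norm] at hlt
  have hmem : x - y ∈ Metric.ball (0 : EuclideanSpace ℝ (Fin d)) ε := by
    simpa using hlt.trans_le (min_le_left _ _)
  refine hball hmem ⟨⟨⟨x, hx, y, hy, rfl⟩, ?_⟩, sub_ne_zero.2 hne⟩
  simpa using (hlt.trans_le (min_le_right _ _)).le

theorem IsMeyer.uniformlyDiscrete {d : ℕ} {M : Set (EuclideanSpace ℝ (Fin d))} (hM : IsMeyer M) :
    UniformlyDiscrete M := by
  obtain ⟨⟨R, -, hcov⟩, r, hr, hsep⟩ := hM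
  obtain ⟨t, ht, -⟩ := hcov 0
  refine ⟨r, hr, fun x hx y hy hne => ?_⟩
  simpa using hsep (x - t) ⟨x, hx, t, ht, rfl⟩ (y - t) ⟨y, hy, t, ht, rfl⟩
    (fun h => hne (sub_left_injective h))

theorem UniformlyDiscrete.finite_add_inter_closedBall {d : ℕ}
    {S F : Set (EuclideanSpace ℝ (Fin d))} (hS : UniformlyDiscrete S) (hF : F.Finite) (ρ : ℝ) :
    ((S + F) ∩ Metric.closedBall 0 ρ).Finite := by
  obtain ⟨C, hC⟩ := hF.isBounded.exists_norm_le
  refine ((hS.finite_inter_closedBall (ρ + C)).add hF).subset ?_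
  rintro _ ⟨⟨s, hs, f, hf, rfl⟩, hsf⟩
  refine ⟨s, ⟨hs, ?_⟩, f, hf, rfl⟩
  simp only [mem_closedBall_zero_iff] at hsf ⊢
  have := norm_sub_le (s + f) f
  rw [add_sub_cancel_right] at this
  linarith [hC f hf]

theorem subset_sub_add_self {G : Type*} [AddGroup G] (M : Set G) : M ⊆ M - M + M :=
  fun x hx => ⟨x - x, ⟨x, hx, x, hx, rfl⟩, x, hx, by simp⟩

/-- If `M` is Meyer then `M - M + M` is Meyer and generates the same subgroup as `M`. -/
theorem meyer_sub_add {d : ℕ} (M : Set (EuclideanSpace ℝ (Fin d))) (hM : IsMeyer M) :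
    IsMeyer (M - M + M) ∧ AddSubgroup.closure (M - M + M) = AddSubgroup.closure M := by
  refine ⟨⟨?_, ?_⟩, le_antisymm ?_ (AddSubgroup.closure_mono (subset_sub_add_self M))⟩
  · obtain ⟨R, hR, hcov⟩ := hM.1
    refine ⟨R, hR, fun y => ?_⟩
    obtain ⟨x, hx, hxy⟩ := hcov y
    exact ⟨x, subset_sub_add_self M hx, hxy⟩
  · obtain ⟨F, hF, hMF⟩ := hM.exists_finite_sub_subset
    obtain ⟨F', hF', h⟩ := exists_finite_nsmul_sub_subset hF hMF 5
    refine uniformlyDiscrete_of_finite_sub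
      ((hM.uniformlyDiscrete.finite_add_inter_closedBall hF' 1).subset
        (Set.inter_subset_inter_left _ (subset_trans (Eq.subset ?_) h)))
    simp only [succ_nsmul, zero_nsmul, sub_eq_add_neg, neg_add, neg_neg, zero_add]
    ac_rfl
  · rw [AddSubgroup.closure_le]
    rintro _ ⟨_, ⟨x, hx, y, hy, rfl⟩, z, hz, rfl⟩
    exact add_mem (sub_mem (AddSubgroup.subset_closure hx) (AddSubgroup.subset_closure hy))
      (AddSubgroup.subset_closure hz)
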